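/- arXiv:2101.09680 — 4 statements merged into one kernel-verified Lean document; each statement's English description precedes it below -/
import Mathlib

section
/- Single selector failure, probability of an SP-supported row being an SP row: let μ be the product measure on Fin N → Fin N → Bool under which the N² entries are independent Bernoulli(q), 0 < q < 1. Fix i ≠ m and j in Fin N and take the SF set φ = {(i,j)}. Then the conditional probability, given the event {X i j = true ∧ X m j = true} (the SF is active and row m is SP-supported), that row m contains an SP cell equals 1 − (1 − (1−q)q)^{N−1}. (By the structure of single-SF arrays, such a row is then a complete-SP row.) -/
open MeasureTheory

/-- Bernoulli(q) measure on `Bool`: `true` has probability `q`. -/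
noncomputable def bern (q : ℝ) : Measure Bool :=
  (ENNReal.ofReal q) • Measure.dirac true + (ENNReal.ofReal (1 - q)) • Measure.dirac false

instance (q : ℝ) : IsFiniteMeasure (bern q) := by
  constructor
  simp [bern, Measure.add_apply, Measure.smul_apply]

/-- Product measure on `Fin N → Fin N → Bool` making the `N²` entries i.i.d. Bernoulli(q). -/
noncomputable def arrMeasure (N : ℕ) (q : ℝ) : Measure (Fin N → Fin N → Bool) :=
  Measure.pi fun _ => Measure.pi fun _ => bern q

open ProbabilityTheory in
theorem arr_cols (N : ℕ) (q : ℝ) (hq0 : 0 < q) (hq1 : q < 1)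
    (i m : Fin N) (him : i ≠ m) (S : Fin N → Set (Bool × Bool)) :
    arrMeasure N q {X | ∀ n, (X i n, X m n) ∈ S n} = ∏ n, ((bern q).prod (bern q)) (S n) := by
  haveI : IsProbabilityMeasure (bern q) := by
    constructor
    simp only [bern, Measure.add_apply, Measure.smul_apply, measure_univ, smul_eq_mul, mul_one]
    rw [← ENNReal.ofReal_add hq0.le (by linarith)]
    simp
  have h1 : iIndepFun (fun k (X : Fin N → Fin N → Bool) => X k) (arrMeasure N q) :=
    iIndepFun_pi (X := fun _ x => x) (fun _ => aemeasurable_id)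
  have h2 := h1.indepFun him
  have hev (k : Fin N) : MeasurePreserving (fun X : Fin N → Fin N → Bool => X k)
      (arrMeasure N q) (Measure.pi fun _ => bern q) := measurePreserving_eval _ k
  haveI : IsProbabilityMeasure (arrMeasure N q) := by unfold arrMeasure; infer_instance
  rw [indepFun_iff_map_prod_eq_prod_map_map (hev i).aemeasurable (hev m).aemeasurable,
    (hev i).map_eq, (hev m).map_eq] at h2
  have h3 := measurePreserving_arrowProdEquivProdArrow Bool Bool (Fin N)
    (fun _ => bern q) (fun _ => bern q)
  set T : Set ((Fin N → Bool) × (Fin N → Bool)) := {p | ∀ n, (p.1 n, p.2 n) ∈ S n} with hT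
  have hTm : MeasurableSet T := T.toFinite.measurableSet
  have e1 : arrMeasure N q {X | ∀ n, (X i n, X m n) ∈ S n} =
      ((Measure.pi fun _ => bern q).prod (Measure.pi fun _ => bern q)) T := by
    rw [← h2, Measure.map_apply ((hev i).measurable.prodMk (hev m).measurable) hTm]
    rfl
  rw [e1, ← h3.measure_preimage hTm.nullMeasurableSet, ← Measure.pi_pi]
  congr 1
  ext f
  simp [hT, MeasurableEquiv.arrowProdEquivProdArrow, Equiv.arrowProdEquivProdArrow]

theorem bern_tt (q : ℝ) (hq0 : 0 < q) :
    ((bern q).prod (bern q)) {(true, true)} = ENNReal.ofReal (q * q) := by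
  rw [← Set.singleton_prod_singleton, Measure.prod_prod, ENNReal.ofReal_mul hq0.le]
  simp [bern]

theorem bern_univ (q : ℝ) (hq0 : 0 < q) (hq1 : q < 1) :
    ((bern q).prod (bern q)) Set.univ = 1 := by
  have : bern q Set.univ = 1 := by
    simp only [bern, Measure.add_apply, Measure.smul_apply, measure_univ, smul_eq_mul, mul_one]
    rw [← ENNReal.ofReal_add hq0.le (by linarith)]
    simp
  rw [← Set.univ_prod_univ, Measure.prod_prod, this, mul_one]

theorem bern_tf (q : ℝ) (hq0 : 0 < q) (hq1 : q < 1) :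
    ((bern q).prod (bern q)) {(true, false)}ᶜ = ENNReal.ofReal (1 - (1 - q) * q) := by
  have h : ((bern q).prod (bern q)) {(true, false)} = ENNReal.ofReal ((1 - q) * q) := by
    rw [← Set.singleton_prod_singleton, Measure.prod_prod, mul_comm (1 - q),
      ENNReal.ofReal_mul hq0.le]
    simp [bern]
  rw [measure_compl (MeasurableSet.singleton _) (measure_ne_top _ _), bern_univ q hq0 hq1, h,
    ENNReal.ofReal_sub _ (by nlinarith), ENNReal.ofReal_one]

theorem prod_one_special {N : ℕ} (j : Fin N) (a b : ENNReal) :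
    ∏ n : Fin N, (if n = j then a else b) = a * b ^ (N - 1) := by
  rw [← Finset.mul_prod_erase _ _ (Finset.mem_univ j), if_pos rfl,
    Finset.prod_congr rfl (g := fun _ => b)]
  · simp [Finset.card_erase_of_mem]
  · intro x hx
    rw [if_neg (Finset.ne_of_mem_erase hx)]

/-- Single selector failure at `(i,j)`: conditioned on the SF being active
(`X i j = true`) and row `m ≠ i` being SP-supported (`X m j = true`), the probability
that row `m` contains an SP cell equals `1 − (1 − (1−q)q)^{N−1}`. -/
theorem single_sf_supported_row_is_sp_row_prob
    (N : ℕ) (hN : 2 ≤ N) (q : ℝ) (hq0 : 0 < q) (hq1 : q < 1)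
    (i m j : Fin N) (him : i ≠ m) :
    (arrMeasure N q) ({X : Fin N → Fin N → Bool |
        ∃ n : Fin N, X m n = false ∧ X i j = true ∧ X i n = true ∧ X m j = true} ∩
      {X : Fin N → Fin N → Bool | X i j = true ∧ X m j = true})
      / (arrMeasure N q) {X : Fin N → Fin N → Bool | X i j = true ∧ X m j = true}
    = ENNReal.ofReal (1 - (1 - (1 - q) * q) ^ (N - 1)) := by
  set B := {X : Fin N → Fin N → Bool | X i j = true ∧ X m j = true} with hB
  set A := {X : Fin N → Fin N → Bool |
        ∃ n : Fin N, X m n = false ∧ X i j = true ∧ X i n = true ∧ X m j = true} with hA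
  have hBm : arrMeasure N q B = ENNReal.ofReal (q * q) := by
    have := arr_cols N q hq0 hq1 i m him (fun n => if n = j then {(true, true)} else Set.univ)
    simp only [apply_ite ((bern q).prod (bern q)), bern_tt q hq0, bern_univ q hq0 hq1,
      prod_one_special, one_pow, mul_one] at this
    rw [← this]
    congr 1
    ext X
    constructor
    · rintro ⟨h1, h2⟩ n
      by_cases hn : n = j
      · subst hn; simp [h1, h2]
      · simp [hn]
    · intro h
      have hj : X i j = true ∧ X m j = true := by simpa using h j
      exact hj
  have hDm : arrMeasure N q (B \ A) =
      ENNReal.ofReal (q * q) * ENNReal.ofReal (1 - (1 - q) * q) ^ (N - 1) := by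
    have := arr_cols N q hq0 hq1 i m him
      (fun n => if n = j then {(true, true)} else {(true, false)}ᶜ)
    simp only [apply_ite ((bern q).prod (bern q)), bern_tt q hq0, bern_tf q hq0 hq1,
      prod_one_special] at this
    rw [← this]
    congr 1
    ext X
    constructor
    · rintro ⟨⟨h1, h2⟩, h3⟩ n
      by_cases hn : n = j
      · subst hn; simp [h1, h2]
      · simp only [hn, if_false, Set.mem_compl_iff, Set.mem_singleton_iff, Prod.mk.injEq]
        rintro ⟨h4, h5⟩
        exact h3 ⟨n, h5, h1, h4, h2⟩
    · intro h
      have hj : X i j = true ∧ X m j = true := by simpa using h j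
      refine ⟨hj, ?_⟩
      rintro ⟨n, h5, h1, h4, h2⟩
      have hn := h n
      by_cases hnj : n = j
      · subst hnj; simp [h5] at h2
      · simp [hnj, h4, h5] at hn
  have hr : 0 ≤ 1 - (1 - q) * q := by nlinarith
  have hfin : arrMeasure N q (B \ A) ≠ ⊤ := by
    rw [hDm]
    exact ENNReal.mul_ne_top ENNReal.ofReal_ne_top (ENNReal.pow_ne_top ENNReal.ofReal_ne_top)
  have hAB : A ∩ B = B \ (B \ A) := by
    rw [Set.sdiff_sdiff_right_self, Set.inter_comm]
  rw [hAB, measure_sdiff Set.sdiff_subset (Set.toFinite _).measurableSet.nullMeasurableSet hfin,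
    hBm, hDm, ← ENNReal.ofReal_pow hr, ← ENNReal.ofReal_mul (by positivity),
    ← ENNReal.ofReal_sub _ (by positivity), ← ENNReal.ofReal_div_of_pos (by positivity)]
  congr 1
  field_simp
end

section
/- Double selector failure, a complete-SP row is double-SP-supported with high probability: let μ be the product Bernoulli(q) measure on Fin N → Fin N → Bool with N ≥ 3, 0 < q < 1. Fix φ = {(i,j),(i',j')} with i ≠ i', j ≠ j', and m ∉ {i,i'}. Let A = {X i j = true ∧ X i' j' = true} (both SFs active), E = {row m is a complete-SP row}, and E₂ = {X m j = true ∧ X m j' = true} (row m double-SP-supported). Then μ(E₂ | E ∩ A) ≥ 1 − 2(1 − q(1−q)²)^{N−2}/q². -/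
open MeasureTheory

/-- Cell `(m,n)` is an SP cell for the double-SF set `{(i,j),(i',j')}` (both active). -/
def IsSPCellDouble (N : ℕ) (X : Fin N → Fin N → Bool)
    (i i' j j' m n : Fin N) : Prop :=
  X m n = false ∧
    ((X i n = true ∧ X m j = true) ∨ (X i' n = true ∧ X m j' = true))

/-- Row `m` is a complete-SP row: it contains an SP cell, and every critical cell
`(m,n)` with `n ∉ {j,j'}` (row `m` SP-supported and column `n` SP-supported) is
either LRS (`true`) or an SP cell. -/
def IsCompleteSPRow (N : ℕ) (X : Fin N → Fin N → Bool)
    (i i' j j' m : Fin N) : Prop :=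
  (∃ n : Fin N, IsSPCellDouble N X i i' j j' m n) ∧
  ∀ n : Fin N, n ≠ j → n ≠ j' → (X m j = true ∨ X m j' = true) →
    (X i n = true ∨ X i' n = true) →
    X m n = true ∨ IsSPCellDouble N X i i' j j' m n

theorem aux_bern_true (q : ℝ) (h0 : 0 < q) : (bern q).real {true} = q := by
  simp [bern, Measure.real, Measure.add_apply, Measure.smul_apply, h0.le]

theorem aux_bern_false (q : ℝ) (h1 : q < 1) : (bern q).real {false} = 1 - q := by
  simp [bern, Measure.real, Measure.add_apply, Measure.smul_apply, h1.le]

theorem aux_bern_prob (q : ℝ) (h0 : 0 < q) (h1 : q < 1) : IsProbabilityMeasure (bern q) := by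
  constructor
  simp only [bern, Measure.add_apply, Measure.smul_apply, measure_univ, smul_eq_mul, mul_one]
  rw [← ENNReal.ofReal_add h0.le (by linarith)]
  simp

theorem aux_pi_real {ι : Type*} [Fintype ι] {α : Type*} [MeasurableSpace α]
    (ν : Measure α) [IsProbabilityMeasure ν] (C : ι → Set α) :
    (Measure.pi (fun _ : ι => ν)).real (Set.univ.pi C) = ∏ k, ν.real (C k) := by
  simp [Measure.real, Measure.pi_pi, ENNReal.toReal_prod]

theorem aux_prod2 {N : ℕ} (f : Fin N → ℝ) (a b : Fin N) (hab : a ≠ b) (w : ℝ)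
    (hw : ∀ k, k ≠ a → k ≠ b → f k = w) : ∏ k, f k = f a * f b * w ^ (N - 2) := by
  rw [← Finset.mul_prod_erase Finset.univ f (Finset.mem_univ a),
    ← Finset.mul_prod_erase (Finset.univ.erase a) f (a := b) (by simp [hab.symm]),
    Finset.prod_congr rfl (g := fun _ => w)]
  · rw [Finset.prod_const, Finset.card_erase_of_mem (by simp [hab.symm]),
      Finset.card_erase_of_mem (by simp)]
    simp [mul_assoc, Nat.sub_sub]
  · intro k hk
    simp at hk
    exact hw k hk.2 hk.1

theorem aux_prod3 {N : ℕ} (f : Fin N → ℝ) (a b c : Fin N) (hab : a ≠ b) (hac : a ≠ c)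
    (hbc : b ≠ c) (hw : ∀ k, k ≠ a → k ≠ b → k ≠ c → f k = 1) :
    ∏ k, f k = f a * f b * f c := by
  rw [← Finset.prod_subset (Finset.subset_univ {a, b, c})]
  · rw [Finset.prod_insert (by simp [hab, hac]), Finset.prod_insert (by simp [hbc])]
    simp [mul_assoc]
  · intro k _ hk
    simp at hk
    exact hw k hk.1 hk.2.1 hk.2.2

theorem aux_col2 {N : ℕ} (ν : Measure Bool) [IsProbabilityMeasure ν] (a b : Fin N)
    (hab : a ≠ b) (x y : Bool) :
    (Measure.pi (fun _ : Fin N => ν)).real {c | c a = x ∧ c b = y}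
      = ν.real {x} * ν.real {y} := by
  have : {c : Fin N → Bool | c a = x ∧ c b = y}
      = Set.univ.pi (fun k => if k = a then {x} else if k = b then {y} else Set.univ) := by
    ext c
    simp only [Set.mem_ofPred_eq, Set.mem_pi, Set.mem_univ, true_imp_iff]
    constructor
    · rintro ⟨h1, h2⟩ k
      split_ifs with h h' <;> simp_all
    · intro h
      have h1 := h a
      have h2 := h b
      simp_all [hab.symm]
  rw [this, aux_pi_real, aux_prod2 _ a b hab 1]
  · simp [hab.symm]
  · intro k h1 h2
    rw [if_neg h1, if_neg h2, probReal_univ]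

theorem aux_col3 {N : ℕ} (ν : Measure Bool) [IsProbabilityMeasure ν] (a b d : Fin N)
    (hab : a ≠ b) (had : a ≠ d) (hbd : b ≠ d) (x y z : Bool) :
    (Measure.pi (fun _ : Fin N => ν)).real {c | c a = x ∧ c b = y ∧ c d = z}
      = ν.real {x} * ν.real {y} * ν.real {z} := by
  have : {c : Fin N → Bool | c a = x ∧ c b = y ∧ c d = z}
      = Set.univ.pi (fun k => if k = a then {x} else if k = b then {y} else
          if k = d then {z} else Set.univ) := by
    ext c
    simp only [Set.mem_ofPred_eq, Set.mem_pi, Set.mem_univ, true_imp_iff]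
    constructor
    · rintro ⟨h1, h2, h3⟩ k
      split_ifs with h h' h'' <;> simp_all
    · intro h
      have h1 := h a
      have h2 := h b
      have h3 := h d
      simp_all [hab.symm, had.symm, hbd.symm]
  rw [this, aux_pi_real, aux_prod3 _ a b d hab had hbd]
  · simp [hab.symm, had.symm, hbd.symm]
  · intro k h1 h2 h3
    rw [if_neg h1, if_neg h2, if_neg h3, probReal_univ]

theorem aux_swap (N : ℕ) (q : ℝ) :
    (arrMeasure N q).map (fun X a b => X b a) = arrMeasure N q := by
  apply Measure.ext_of_singleton
  intro X
  rw [Measure.map_apply (measurable_of_finite _) (measurableSet_singleton _)]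
  have h : (fun (X : Fin N → Fin N → Bool) a b => X b a) ⁻¹' {X} = {fun a b => X b a} := by
    ext Y
    simp only [Set.mem_preimage, Set.mem_singleton_iff]
    constructor
    · rintro rfl; rfl
    · rintro rfl; rfl
  rw [h]
  simp only [arrMeasure, Measure.pi_singleton]
  exact Finset.prod_comm

theorem aux_cols (N : ℕ) (q : ℝ) (h0 : 0 < q) (h1 : q < 1) (C : Fin N → Set (Fin N → Bool)) :
    (arrMeasure N q).real {X | ∀ n, (fun a => X a n) ∈ C n}
      = ∏ n, (Measure.pi (fun _ : Fin N => bern q)).real (C n) := by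
  have := aux_bern_prob q h0 h1
  rw [← aux_pi_real, ← aux_swap, Measure.real,
    Measure.map_apply (measurable_of_finite _) (Set.toFinite _).measurableSet]
  unfold Measure.real
  congr 1
  unfold arrMeasure
  congr 1
  ext X
  simp

theorem aux_upper (N : ℕ) (q : ℝ) (hq0 : 0 < q) (hq1 : q < 1)
    (i i' j j' m : Fin N)
    (hii : i ≠ i') (hjj : j ≠ j') (hmi : m ≠ i) (hmi' : m ≠ i') :
    (arrMeasure N q).real {X | (X m j = true ∧ X m j' = false) ∧
      IsCompleteSPRow N X i i' j j' m ∧ X i j = true ∧ X i' j' = true}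
    ≤ q ^ 3 * (1 - q) * (1 - q * (1 - q) ^ 2) ^ (N - 2) := by
  have := aux_bern_prob q hq0 hq1
  have : IsProbabilityMeasure (arrMeasure N q) := by unfold arrMeasure; infer_instance
  let C : Fin N → Set (Fin N → Bool) := fun n =>
    if n = j then {c | c i = true ∧ c m = true} else
    if n = j' then {c | c i' = true ∧ c m = false} else
    {c | c i' = true ∧ c i = false ∧ c m = false}ᶜ
  have hC := aux_cols N q hq0 hq1 C
  rw [aux_prod2 _ j j' hjj (1 - q * (1 - q) ^ 2)] at hC
  · simp only [C, if_true, if_neg hjj.symm] at hC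
    rw [aux_col2 _ _ _ hmi.symm, aux_col2 _ _ _ hmi'.symm, aux_bern_true q hq0,
      aux_bern_false q hq1] at hC
    calc _ ≤ _ := measureReal_mono ?_
      _ = _ := hC
      _ = _ := by ring
    rintro X ⟨⟨a1, a2⟩, ⟨-, h⟩, a3, a4⟩ n
    split_ifs with e1 e2
    · subst e1; exact ⟨a3, a1⟩
    · subst e2; exact ⟨a4, a2⟩
    · rintro ⟨b1, b2, b3⟩
      dsimp only at b1 b2 b3
      have := h n e1 e2 (Or.inl a1) (Or.inr b1)
      simp [IsSPCellDouble, a1, a2, b1, b2, b3] at this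
  · intro k h1 h2
    simp only [C, if_neg h1, if_neg h2]
    rw [probReal_compl_eq_one_sub (Set.toFinite _).measurableSet,
      aux_col3 _ _ _ _ hii.symm hmi'.symm hmi.symm, aux_bern_true q hq0,
      aux_bern_false q hq1]
    ring

theorem aux_lower (N : ℕ) (hN : 3 ≤ N) (q : ℝ) (hq0 : 0 < q) (hq1 : q < 1)
    (i i' j j' m : Fin N)
    (hjj : j ≠ j') (hmi : m ≠ i) (hmi' : m ≠ i') :
    q ^ 5 * (1 - q) ≤ (arrMeasure N q).real ({X | IsCompleteSPRow N X i i' j j' m} ∩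
      {X | X i j = true ∧ X i' j' = true}) := by
  have := aux_bern_prob q hq0 hq1
  have : IsProbabilityMeasure (arrMeasure N q) := by unfold arrMeasure; infer_instance
  obtain ⟨n0, hn⟩ : ∃ n0 : Fin N, n0 ∉ ({j, j'} : Finset (Fin N)) := by
    by_contra! h
    have h1 : (Finset.univ : Finset (Fin N)) ⊆ {j, j'} := fun x _ => h x
    have h2 := Finset.card_le_card h1
    have h3 := Finset.card_le_two (a := j) (b := j')
    simp at h2
    omega
  simp only [Finset.mem_insert, Finset.mem_singleton, not_or] at hn
  obtain ⟨hn1, hn2⟩ := hn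
  let C : Fin N → Set (Fin N → Bool) := fun n =>
    if n = j then {c | c i = true ∧ c m = true} else
    if n = j' then {c | c i' = true ∧ c m = true} else
    if n = n0 then {c | c i = true ∧ c m = false} else Set.univ
  have hC := aux_cols N q hq0 hq1 C
  rw [aux_prod3 _ j j' n0 hjj (Ne.symm hn1) (Ne.symm hn2)] at hC
  · simp only [C, if_true, if_neg hjj.symm, if_neg hn1, if_neg hn2] at hC
    rw [aux_col2 _ _ _ hmi.symm, aux_col2 _ _ _ hmi'.symm, aux_col2 _ _ _ hmi.symm,
      aux_bern_true q hq0, aux_bern_false q hq1] at hC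
    calc _ = _ := by ring
      _ = _ := hC.symm
      _ ≤ _ := measureReal_mono ?_
    intro X hX
    have c1 := hX j
    have c2 := hX j'
    have c3 := hX n0
    simp [hjj.symm, hn1, hn2] at c1 c2 c3
    refine ⟨⟨⟨n0, c3.2, Or.inl ⟨c3.1, c1.2⟩⟩, ?_⟩, c1.1, c2.1⟩
    intro n _ _ _ h
    simp only [IsSPCellDouble, c1.2, c2.2]
    cases X m n <;> simp [h]
  · intro k h1 h2 h3
    simp only [C, if_neg h1, if_neg h2, if_neg h3, probReal_univ]

/-- Double selector failure: conditioned on both SFs being active and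
row `m ∉ {i,i'}` being a complete-SP row, row `m` is double-SP-supported with
probability at least `1 − 2(1 − q(1−q)²)^{N−2}/q²`. -/
theorem double_sf_complete_sp_row_is_double_supported_prob
    (N : ℕ) (hN : 3 ≤ N) (q : ℝ) (hq0 : 0 < q) (hq1 : q < 1)
    (i i' j j' m : Fin N)
    (hii : i ≠ i') (hjj : j ≠ j') (hmi : m ≠ i) (hmi' : m ≠ i') :
    (arrMeasure N q) ({X : Fin N → Fin N → Bool | X m j = true ∧ X m j' = true} ∩
      ({X : Fin N → Fin N → Bool | IsCompleteSPRow N X i i' j j' m} ∩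
       {X : Fin N → Fin N → Bool | X i j = true ∧ X i' j' = true}))
      / (arrMeasure N q)
        ({X : Fin N → Fin N → Bool | IsCompleteSPRow N X i i' j j' m} ∩
         {X : Fin N → Fin N → Bool | X i j = true ∧ X i' j' = true})
    ≥ ENNReal.ofReal (1 - 2 * (1 - q * (1 - q) ^ 2) ^ (N - 2) / q ^ 2) := by
  have := aux_bern_prob q hq0 hq1
  have : IsProbabilityMeasure (arrMeasure N q) := by unfold arrMeasure; infer_instance
  have hL := aux_lower N hN q hq0 hq1 i i' j j' m hjj hmi hmi'
  have hU1 := aux_upper N q hq0 hq1 i i' j j' m hii hjj hmi hmi'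
  have hU2 := aux_upper N q hq0 hq1 i' i j' j m hii.symm hjj.symm hmi' hmi
  set E2 := {X : Fin N → Fin N → Bool | X m j = true ∧ X m j' = true} with hE2
  set D := ({X : Fin N → Fin N → Bool | IsCompleteSPRow N X i i' j j' m} ∩
         {X : Fin N → Fin N → Bool | X i j = true ∧ X i' j' = true}) with hD
  set B1 := {X : Fin N → Fin N → Bool | (X m j = true ∧ X m j' = false) ∧
      IsCompleteSPRow N X i i' j j' m ∧ X i j = true ∧ X i' j' = true} with hB1
  set B2 := {X : Fin N → Fin N → Bool | (X m j' = true ∧ X m j = false) ∧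
      IsCompleteSPRow N X i' i j' j m ∧ X i' j' = true ∧ X i j = true} with hB2
  have hsub : D ⊆ (E2 ∩ D) ∪ (B1 ∪ B2) := by
    rintro X ⟨⟨⟨n, hn⟩, h⟩, h1, h2⟩
    have hn' := hn
    rcases e1 : X m j with _ | _ <;> rcases e2 : X m j' with _ | _
    · simp [IsSPCellDouble, e1, e2] at hn
    · refine Or.inr (Or.inr ⟨⟨e2, e1⟩, ⟨⟨n, hn.1, hn.2.symm⟩, ?_⟩, h2, h1⟩)
      intro k k1 k2 k3 k4
      exact (h k k2 k1 k3.symm k4.symm).imp id fun z => ⟨z.1, z.2.symm⟩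
    · exact Or.inr (Or.inl ⟨⟨e1, e2⟩, ⟨⟨n, hn⟩, h⟩, h1, h2⟩)
    · exact Or.inl ⟨⟨e1, e2⟩, ⟨⟨n, hn⟩, h⟩, h1, h2⟩
  have h3 : (arrMeasure N q).real D ≤ (arrMeasure N q).real (E2 ∩ D) +
      ((arrMeasure N q).real B1 + (arrMeasure N q).real B2) :=
    (measureReal_mono hsub).trans ((measureReal_union_le _ _).trans
      (by gcongr; exact measureReal_union_le _ _))
  have hpos : 0 < q ^ 5 * (1 - q) := mul_pos (by positivity) (by linarith)
  have hDpos := hpos.trans_le hL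
  rw [ge_iff_le, ← ofReal_measureReal (s := E2 ∩ D), ← ofReal_measureReal (s := D),
    ← ENNReal.ofReal_div_of_pos hDpos]
  apply ENNReal.ofReal_le_ofReal
  rw [le_div_iff₀ hDpos]
  have hr : 0 ≤ 1 - q * (1 - q) ^ 2 := by nlinarith [mul_pos hq0 (sub_pos.2 hq1)]
  have hrk := pow_nonneg hr (N - 2)
  set R := (1 - q * (1 - q) ^ 2) ^ (N - 2)
  have h4 : 2 * R / q ^ 2 * (q ^ 5 * (1 - q)) ≤ 2 * R / q ^ 2 * (arrMeasure N q).real D := by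
    gcongr
  have h5 : 2 * R / q ^ 2 * (q ^ 5 * (1 - q)) = 2 * (q ^ 3 * (1 - q) * R) := by
    field_simp
  linarith
end

section
/- Double selector failure, non-SP SF row and column imply the intersection entry is 0 with high probability: let μ be the product Bernoulli(q) measure on Fin N → Fin N → Bool with N ≥ 2, 0 < q < 1. Fix φ = {(i,j),(i',j')} with i ≠ i', j ≠ j'. Then the conditional probability, given the event {X i j = true ∧ X i' j' = true} ∩ {row i contains no SP cell} ∩ {column j' contains no SP cell}, that X i j' = false is at least 1 − q(q + (1−q)²)^{2N−4}/(1−q). -/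
open MeasureTheory

lemma bern_apply' (q : ℝ) (s : Set Bool) [Decidable (true ∈ s)] [Decidable (false ∈ s)] :
    bern q s = (if true ∈ s then ENNReal.ofReal q else 0)
      + (if false ∈ s then ENNReal.ofReal (1 - q) else 0) := by
  simp [bern, Measure.add_apply, Measure.smul_apply, Set.indicator_apply]

lemma ofReal_add_one_sub {q : ℝ} (hq0 : 0 < q) (hq1 : q < 1) :
    ENNReal.ofReal q + ENNReal.ofReal (1 - q) = 1 := by
  rw [← ENNReal.ofReal_add hq0.le (by linarith)]; simp

lemma prod_two {N : ℕ} {j j' : Fin N} (hjj : j ≠ j') (g : Fin N → ENNReal) (c : ENNReal)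
    (hg : ∀ n, n ≠ j → n ≠ j' → g n = c) : ∏ n, g n = g j * g j' * c ^ (N - 2) := by
  classical
  rw [← Finset.mul_prod_erase Finset.univ g (Finset.mem_univ j),
    ← Finset.mul_prod_erase (Finset.univ.erase j) g (a := j') (by simp [hjj.symm]), mul_assoc]
  congr 2
  rw [Finset.prod_congr rfl (g := fun _ => c)]
  · rw [Finset.prod_const, Finset.card_erase_of_mem (by simp [hjj.symm]),
      Finset.card_erase_of_mem (by simp)]
    simp [Nat.sub_sub]
  · intro n hn
    simp at hn
    exact hg n hn.2 hn.1

lemma row_two {N : ℕ} {q : ℝ} (hq0 : 0 < q) (hq1 : q < 1) {j j' : Fin N} (hjj : j ≠ j')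
    (a b : Set Bool) :
    (Measure.pi fun _ : Fin N => bern q) {f | f j ∈ a ∧ f j' ∈ b} = bern q a * bern q b := by
  classical
  have h1 := ofReal_add_one_sub hq0 hq1
  have : {f : Fin N → Bool | f j ∈ a ∧ f j' ∈ b} =
      Set.pi Set.univ (fun n => if n = j then a else if n = j' then b else Set.univ) := by
    ext f
    simp only [Set.mem_ofPred_eq, Set.mem_pi, Set.mem_univ, true_implies]
    constructor
    · rintro ⟨h, h'⟩ n
      split_ifs with h1 h2
      · subst h1; exact h
      · subst h2; exact h'
      · trivial
    · intro h
      have := h j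
      have := h j'
      simp_all [hjj.symm]
  rw [this, Measure.pi_pi, prod_two hjj _ 1]
  · simp [hjj.symm]
  · intro n h h'
    simp [h, h', bern_apply', h1]

lemma row_R {N : ℕ} {q : ℝ} (hq0 : 0 < q) (hq1 : q < 1) {j j' : Fin N} (hjj : j ≠ j') :
    (Measure.pi fun _ : Fin N => bern q) {f | ¬ (f j' = false ∧ f j = true)}
      ≤ ENNReal.ofReal (q + (1 - q) ^ 2) := by
  have h1 := ofReal_add_one_sub hq0 hq1
  have hs : {f : Fin N → Bool | ¬ (f j' = false ∧ f j = true)} ⊆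
      {f | f j ∈ (Set.univ : Set Bool) ∧ f j' ∈ ({true} : Set Bool)} ∪
      {f | f j ∈ ({false} : Set Bool) ∧ f j' ∈ ({false} : Set Bool)} := by
    intro f
    simp
    cases f j <;> cases f j' <;> simp
  refine (measure_mono hs).trans ((measure_union_le _ _).trans ?_)
  rw [row_two hq0 hq1 hjj, row_two hq0 hq1 hjj, ENNReal.ofReal_add hq0.le (by positivity),
    ENNReal.ofReal_pow (by linarith)]
  simp [bern_apply', h1, sq]

lemma F_eq {N : ℕ} {q : ℝ} (hq0 : 0 < q) (hq1 : q < 1) {i i' j j' : Fin N}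
    (hii : i ≠ i') (hjj : j ≠ j') :
    arrMeasure N q {X | (X i j = true ∧ X i j' = false) ∧ X i' j' = true}
      = ENNReal.ofReal ((1 - q) * q ^ 2) := by
  classical
  have h1 := ofReal_add_one_sub hq0 hq1
  have : {X : Fin N → Fin N → Bool | (X i j = true ∧ X i j' = false) ∧ X i' j' = true} =
      Set.pi Set.univ (fun m => if m = i then {f | f j ∈ ({true} : Set Bool) ∧ f j' ∈ ({false} : Set Bool)}
        else if m = i' then {f | f j ∈ (Set.univ : Set Bool) ∧ f j' ∈ ({true} : Set Bool)}
        else {f | f j ∈ (Set.univ : Set Bool) ∧ f j' ∈ (Set.univ : Set Bool)}) := by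
    ext X
    simp only [Set.mem_ofPred_eq, Set.mem_pi, Set.mem_univ, true_implies]
    constructor
    · rintro ⟨h, h'⟩ n
      split_ifs with h1 h2
      · subst h1; simpa using h
      · subst h2; simpa using h'
      · simp
    · intro h
      have := h i
      have := h i'
      simp_all [hii.symm]
  rw [this, arrMeasure, Measure.pi_pi, prod_two hii _ 1]
  · simp only [if_true, if_neg hii.symm, row_two hq0 hq1 hjj]
    rw [ENNReal.ofReal_mul (by linarith), ENNReal.ofReal_pow hq0.le]
    simp [bern_apply', h1]
    ring
  · intro n h h'
    simp only [if_neg h, if_neg h', row_two hq0 hq1 hjj]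
    simp [bern_apply', h1]

lemma T_le {N : ℕ} {q : ℝ} (hq0 : 0 < q) (hq1 : q < 1) {i i' j j' : Fin N}
    (hii : i ≠ i') (hjj : j ≠ j') :
    arrMeasure N q {X | (X i j = true ∧ X i j' = true ∧ X i' j' = true) ∧
      (∀ n, ¬ (X i n = false ∧ X i' n = true)) ∧ (∀ m, ¬ (X m j' = false ∧ X m j = true))}
      ≤ ENNReal.ofReal (q ^ 3 * ((q + (1 - q) ^ 2) ^ (N - 2) * (q + (1 - q) ^ 2) ^ (N - 2))) := by
  classical
  have h1 := ofReal_add_one_sub hq0 hq1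
  set r := ENNReal.ofReal (q + (1 - q) ^ 2) with hr
  let A : (Fin N → Bool) → Fin N → Set Bool := fun f n =>
    {b | b = f n ∧ (n = j ∨ n = j' → b = true)}
  let S : (Fin N → Bool) → Fin N → Set Bool := fun f n =>
    {b | (n = j' → b = true) ∧ (n ≠ j → n ≠ j' → f n = false → b = false)}
  let R : Set (Fin N → Bool) := {f | ¬ (f j' = false ∧ f j = true)}
  let P : (Fin N → Bool) → Fin N → Set (Fin N → Bool) := fun f m =>
    if m = i then Set.pi Set.univ (A f) else if m = i' then Set.pi Set.univ (S f) else R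
  have hs : {X : Fin N → Fin N → Bool | (X i j = true ∧ X i j' = true ∧ X i' j' = true) ∧
      (∀ n, ¬ (X i n = false ∧ X i' n = true)) ∧ (∀ m, ¬ (X m j' = false ∧ X m j = true))}
      ⊆ ⋃ f, Set.pi Set.univ (P f) := by
    rintro X ⟨⟨ha, hb, hc⟩, hd, he⟩
    refine Set.mem_iUnion.2 ⟨X i, fun m _ => ?_⟩
    simp only [P]
    split_ifs with h h'
    · subst h
      intro n _
      refine ⟨rfl, ?_⟩
      rintro (rfl | rfl) <;> assumption
    · subst h'
      intro n _
      refine ⟨?_, ?_⟩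
      · rintro rfl; exact hc
      · intro _ _ h0
        have := hd n
        simpa [h0] using this
    · exact he m
  have hP : ∀ f, arrMeasure N q (Set.pi Set.univ (P f)) ≤
      (∏ n, (bern q (A f n) * bern q (S f n))) * r ^ (N - 2) := by
    intro f
    rw [arrMeasure, Measure.pi_pi, prod_two hii _ (Measure.pi (fun _ => bern q) R)]
    · simp only [P, if_true, if_neg hii.symm, Measure.pi_pi, Finset.prod_mul_distrib]
      gcongr
      exact row_R hq0 hq1 hjj
    · intro n h h'
      simp [P, h, h']
  have hsum : ∑ f : Fin N → Bool, ∏ n, (bern q (A f n) * bern q (S f n))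
      = ENNReal.ofReal q ^ 3 * r ^ (N - 2) := by
    let H : Fin N → Bool → ENNReal := fun n c =>
      bern q {b | b = c ∧ (n = j ∨ n = j' → b = true)} *
      bern q {b | (n = j' → b = true) ∧ (n ≠ j → n ≠ j' → c = false → b = false)}
    have : ∑ f : Fin N → Bool, ∏ n, H n (f n) = ∏ n, ∑ c, H n c := by
      rw [Finset.prod_univ_sum, Fintype.piFinset_univ]
    refine Eq.trans this ?_
    rw [prod_two hjj _ r]
    · simp [H, bern_apply', hjj, h1]
      ring
    · intro n h h'
      rw [hr, ENNReal.ofReal_add hq0.le (by positivity), ENNReal.ofReal_pow (by linarith)]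
      simp [H, bern_apply', h, h', h1]
      ring
  refine (measure_mono hs).trans ((measure_iUnion_fintype_le _ _).trans ?_)
  refine (Finset.sum_le_sum fun f _ => hP f).trans ?_
  rw [← Finset.sum_mul, hsum, ENNReal.ofReal_mul (by positivity), ENNReal.ofReal_mul (by positivity),
    ENNReal.ofReal_pow hq0.le, ENNReal.ofReal_pow (by positivity), mul_assoc]

/-- Double selector failure: conditioned on both SFs being active,
SF row `i` containing no SP cell and SF column `j'` containing no SP cell, the
intersection entry `X i j'` is `false` with probability at least
`1 − q(q + (1−q)²)^{2N−4}/(1−q)`. -/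
theorem double_sf_non_sp_sf_row_column_implies_intersection_zero_prob
    (N : ℕ) (hN : 2 ≤ N) (q : ℝ) (hq0 : 0 < q) (hq1 : q < 1)
    (i i' j j' : Fin N)
    (hii : i ≠ i') (hjj : j ≠ j') :
    (arrMeasure N q) ({X : Fin N → Fin N → Bool | X i j' = false} ∩
      ({X : Fin N → Fin N → Bool | X i j = true ∧ X i' j' = true} ∩
       ({X : Fin N → Fin N → Bool | ∀ n : Fin N, ¬ IsSPCellDouble N X i i' j j' i n} ∩
        {X : Fin N → Fin N → Bool | ∀ m : Fin N, ¬ IsSPCellDouble N X i i' j j' m j'})))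
      / (arrMeasure N q)
        ({X : Fin N → Fin N → Bool | X i j = true ∧ X i' j' = true} ∩
         ({X : Fin N → Fin N → Bool | ∀ n : Fin N, ¬ IsSPCellDouble N X i i' j j' i n} ∩
          {X : Fin N → Fin N → Bool | ∀ m : Fin N, ¬ IsSPCellDouble N X i i' j j' m j'}))
    ≥ ENNReal.ofReal (1 - q * (q + (1 - q) ^ 2) ^ (2 * N - 4) / (1 - q)) := by
  set μ := arrMeasure N q with hμ
  set V := ({X : Fin N → Fin N → Bool | X i j' = false} ∩
      ({X : Fin N → Fin N → Bool | X i j = true ∧ X i' j' = true} ∩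
       ({X : Fin N → Fin N → Bool | ∀ n : Fin N, ¬ IsSPCellDouble N X i i' j j' i n} ∩
        {X : Fin N → Fin N → Bool | ∀ m : Fin N, ¬ IsSPCellDouble N X i i' j j' m j'}))) with hV
  set D := ({X : Fin N → Fin N → Bool | X i j = true ∧ X i' j' = true} ∩
         ({X : Fin N → Fin N → Bool | ∀ n : Fin N, ¬ IsSPCellDouble N X i i' j j' i n} ∩
          {X : Fin N → Fin N → Bool | ∀ m : Fin N, ¬ IsSPCellDouble N X i i' j j' m j'})) with hD
  set T := {X : Fin N → Fin N → Bool | (X i j = true ∧ X i j' = true ∧ X i' j' = true) ∧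
      (∀ n, ¬ (X i n = false ∧ X i' n = true)) ∧ (∀ m, ¬ (X m j' = false ∧ X m j = true))} with hT
  haveI : IsFiniteMeasure μ := by rw [hμ, arrMeasure]; infer_instance
  have hTle := T_le hq0 hq1 hii hjj
  have hF := F_eq hq0 hq1 hii hjj
  rw [← hμ] at hTle hF
  rw [← hT] at hTle
  have hFV : ENNReal.ofReal ((1 - q) * q ^ 2) ≤ μ V := by
    rw [← hF]
    apply measure_mono
    rintro X ⟨⟨ha, hb⟩, hc⟩
    refine ⟨hb, ⟨ha, hc⟩, fun n => ?_, fun m => ?_⟩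
    · rintro ⟨h0, ⟨h1, h2⟩ | ⟨h1, h2⟩⟩ <;> simp_all
    · rintro ⟨h0, ⟨h1, h2⟩ | ⟨h1, h2⟩⟩ <;> simp_all
  have hDle : μ D ≤ μ V + μ T := by
    refine (measure_mono ?_).trans (measure_union_le _ _)
    rintro X hX
    rcases hb : X i j' with _ | _
    · exact Or.inl ⟨hb, hX⟩
    · obtain ⟨⟨ha, hc⟩, hd, he⟩ := hX
      refine Or.inr ⟨⟨ha, hb, hc⟩, fun n hn => ?_, fun m hm => ?_⟩
      · exact hd n ⟨hn.1, Or.inr ⟨hn.2, hb⟩⟩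
      · exact he m ⟨hm.1, Or.inl ⟨hb, hm.2⟩⟩
  have hVD : μ V ≤ μ D := measure_mono Set.inter_subset_right
  have hFpos : 0 < (1 - q) * q ^ 2 := by
    have : 0 < 1 - q := by linarith
    positivity
  have hD0 : μ D ≠ 0 := by
    have := (ENNReal.ofReal_pos.2 hFpos).trans_le (hFV.trans hVD)
    exact this.ne'
  rw [ge_iff_le, ENNReal.le_div_iff_mul_le (Or.inl hD0) (Or.inl (measure_ne_top _ _))]
  set x := q * (q + (1 - q) ^ 2) ^ (2 * N - 4) / (1 - q) with hx
  have hq' : 0 < 1 - q := by linarith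
  have hx0 : 0 ≤ x := by positivity
  rcases le_total (1 - x) 0 with h | h
  · rw [ENNReal.ofReal_of_nonpos h]; simp
  refine (mul_le_mul_right hDle _).trans ?_
  have hTx : q ^ 3 * ((q + (1 - q) ^ 2) ^ (N - 2) * (q + (1 - q) ^ 2) ^ (N - 2))
      = x * ((1 - q) * q ^ 2) := by
    rw [hx, ← pow_add, show N - 2 + (N - 2) = 2 * N - 4 by omega]
    field_simp
  rw [hTx] at hTle
  have hv := ENNReal.ofReal_toReal (measure_ne_top μ V)
  have ht := ENNReal.ofReal_toReal (measure_ne_top μ T)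
  have hv0 : 0 ≤ (μ V).toReal := ENNReal.toReal_nonneg
  have ht0 : 0 ≤ (μ T).toReal := ENNReal.toReal_nonneg
  generalize (μ V).toReal = v at *
  generalize (μ T).toReal = t at *
  rw [← hv] at hFV ⊢
  rw [← ht] at hTle ⊢
  rw [ENNReal.ofReal_le_ofReal_iff hv0] at hFV
  rw [ENNReal.ofReal_le_ofReal_iff (by positivity)] at hTle
  rw [← ENNReal.ofReal_add hv0 ht0, ← ENNReal.ofReal_mul h]
  apply ENNReal.ofReal_le_ofReal
  nlinarith [mul_le_mul_of_nonneg_left hFV hx0, mul_nonneg hx0 ht0]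
end

section
/- Double selector failure, upper bound on the probability that a single-SP-supported row is a non-SP row: let μ be the product Bernoulli(q) measure on Fin N → Fin N → Bool with N ≥ 2, 0 < q < 1. Fix φ = {(i,j),(i',j')} with i ≠ i', j ≠ j', and m ∉ {i,i'}. Then the conditional probability, given the event {X i j = true ∧ X i' j' = true ∧ X m j = true ∧ X m j' = false} (both SFs active, row m single-SP-supported), that row m contains no SP cell is at most (q + (1−q)²)^{N−2}. -/
open MeasureTheory

lemma bern_univ_aux (q : ℝ) (hq0 : 0 < q) (hq1 : q < 1) : bern q Set.univ = 1 := by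
  simp only [bern, Measure.add_apply, Measure.smul_apply, measure_univ, smul_eq_mul, mul_one]
  rw [← ENNReal.ofReal_add hq0.le (by linarith)]
  simp

lemma bern_true_aux (q : ℝ) : bern q {true} = ENNReal.ofReal q := by
  simp [bern]

lemma bern_false_aux (q : ℝ) : bern q {false} = ENNReal.ofReal (1 - q) := by
  simp [bern]

lemma arr_swap_aux (N : ℕ) (q : ℝ) :
    (arrMeasure N q).map (fun X n k => X k n) = arrMeasure N q := by
  refine Measure.ext_of_singleton (fun Y => ?_)
  rw [Measure.map_apply (measurable_of_countable _) (measurableSet_singleton _)]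
  have : (fun (X : Fin N → Fin N → Bool) n k => X k n) ⁻¹' {Y} = {fun k n => Y n k} := by
    ext X
    simp only [Set.mem_preimage, Set.mem_singleton_iff]
    constructor
    · rintro rfl; rfl
    · rintro rfl; rfl
  rw [this]
  simp only [arrMeasure, Measure.pi_singleton]
  exact Finset.prod_comm

lemma col_aux (N : ℕ) (q : ℝ) (hq0 : 0 < q) (hq1 : q < 1) (m i : Fin N) (hmi : m ≠ i) :
    (Measure.pi fun _ : Fin N => bern q) {c | ¬ (c m = false ∧ c i = true)}
      ≤ ENNReal.ofReal (q + (1 - q) ^ 2) := by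
  have hu := bern_univ_aux q hq0 hq1
  have h1 : (Measure.pi fun _ : Fin N => bern q) {c | c m = true} = ENNReal.ofReal q := by
    have : {c : Fin N → Bool | c m = true}
        = Set.pi Set.univ (fun k => if k = m then {true} else Set.univ) := by
      ext c
      simp only [Set.mem_ofPred_eq, Set.mem_pi, Set.mem_univ, true_imp_iff]
      constructor
      · intro h k
        split_ifs with hk
        · subst hk; exact h
        · trivial
      · intro h; simpa using h m
    rw [this, Measure.pi_pi, Finset.prod_eq_single m]
    · simp [bern_true_aux]
    · intro b _ hb; simp only [hb, if_false, hu]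
    · simp
  have h2 : (Measure.pi fun _ : Fin N => bern q) {c | c m = false ∧ c i = false}
      = ENNReal.ofReal (1 - q) * ENNReal.ofReal (1 - q) := by
    have : {c : Fin N → Bool | c m = false ∧ c i = false}
        = Set.pi Set.univ (fun k => if k = m ∨ k = i then {false} else Set.univ) := by
      ext c
      simp only [Set.mem_ofPred_eq, Set.mem_pi, Set.mem_univ, true_imp_iff]
      constructor
      · intro h k
        split_ifs with hk
        · rcases hk with rfl | rfl
          · exact h.1
          · exact h.2
        · trivial
      · intro h
        exact ⟨by simpa using h m, by simpa using h i⟩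
    rw [this, Measure.pi_pi, Finset.prod_eq_mul m i hmi]
    · simp [bern_false_aux]
    · intro b _ hb; simp only [hb.1, hb.2, or_self, if_false, hu]
    · simp
    · simp
  have hsub : {c : Fin N → Bool | ¬ (c m = false ∧ c i = true)}
      ⊆ {c | c m = true} ∪ {c | c m = false ∧ c i = false} := by
    intro c
    simp only [Set.mem_ofPred_eq, Set.mem_union]
    cases c m <;> cases c i <;> simp
  refine (measure_mono hsub).trans ((measure_union_le _ _).trans ?_)
  rw [h1, h2, ← ENNReal.ofReal_mul (by linarith), ← ENNReal.ofReal_add hq0.le (by nlinarith), sq]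

/-- Double selector failure: conditioned on both SFs being active and
row `m ∉ {i,i'}` being single-SP-supported (`X m j = true`, `X m j' = false`), row `m`
contains no SP cell with probability at most `(q + (1−q)²)^{N−2}`. -/
theorem double_sf_single_supported_row_non_sp_prob_le
    (N : ℕ) (hN : 2 ≤ N) (q : ℝ) (hq0 : 0 < q) (hq1 : q < 1)
    (i i' j j' m : Fin N)
    (hii : i ≠ i') (hjj : j ≠ j') (hmi : m ≠ i) (hmi' : m ≠ i') :
    (arrMeasure N q) ({X : Fin N → Fin N → Bool |
        ∀ n : Fin N, ¬ IsSPCellDouble N X i i' j j' m n} ∩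
      {X : Fin N → Fin N → Bool |
        X i j = true ∧ X i' j' = true ∧ X m j = true ∧ X m j' = false})
      / (arrMeasure N q) {X : Fin N → Fin N → Bool |
        X i j = true ∧ X i' j' = true ∧ X m j = true ∧ X m j' = false}
    ≤ ENNReal.ofReal ((q + (1 - q) ^ 2) ^ (N - 2)) := by
  classical
  refine ENNReal.div_le_of_le_mul ?_
  set ν := Measure.pi fun _ : Fin N => bern q with hν
  have hνu : ν Set.univ = 1 := by
    rw [hν, Measure.pi_univ]
    simp only [bern_univ_aux q hq0 hq1, Finset.prod_const_one]
  have key : ∀ S : Fin N → Set (Fin N → Bool),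
      (arrMeasure N q) {X | ∀ n, (fun k => X k n) ∈ S n} = ∏ n, ν (S n) := by
    intro S
    have h : (arrMeasure N q) (Set.pi Set.univ S) = ∏ n, ν (S n) := by
      rw [arrMeasure, Measure.pi_pi]
    rw [← h]
    conv_rhs => rw [← arr_swap_aux N q]
    rw [Measure.map_apply (measurable_of_countable _) (Set.to_countable _).measurableSet]
    congr 1
    ext X
    simp
  let S : Fin N → Set (Fin N → Bool) := fun n =>
    if n = j then {c | c i = true ∧ c m = true}
    else if n = j' then {c | c i' = true ∧ c m = false} else Set.univ
  let T : Fin N → Set (Fin N → Bool) := fun n =>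
    if n = j ∨ n = j' then S n else {c | ¬ (c m = false ∧ c i = true)}
  have hB : {X : Fin N → Fin N → Bool |
        X i j = true ∧ X i' j' = true ∧ X m j = true ∧ X m j' = false}
      = {X | ∀ n, (fun k => X k n) ∈ S n} := by
    ext X
    simp only [Set.mem_ofPred_eq]
    constructor
    · rintro ⟨h1, h2, h3, h4⟩ n
      by_cases hn : n = j
      · subst hn; simp [S, h1, h3]
      · by_cases hn' : n = j'
        · subst hn'; simp [S, hn, h2, h4]
        · simp [S, hn, hn']
    · intro h
      have a := h j
      have b := h j'
      simp [S] at a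
      simp [S, hjj.symm] at b
      exact ⟨a.1, b.1, a.2, b.2⟩
  have hA : ({X : Fin N → Fin N → Bool |
        ∀ n : Fin N, ¬ IsSPCellDouble N X i i' j j' m n} ∩
      {X : Fin N → Fin N → Bool |
        X i j = true ∧ X i' j' = true ∧ X m j = true ∧ X m j' = false})
      ⊆ {X | ∀ n, (fun k => X k n) ∈ T n} := by
    rintro X ⟨hX, hX'⟩ n
    have hS : ∀ n, (fun k => X k n) ∈ S n := by rw [hB] at hX'; exact hX'
    by_cases hn : n = j ∨ n = j'
    · simp only [T, if_pos hn]; exact hS n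
    · simp only [T, if_neg hn, Set.mem_ofPred_eq]
      rintro ⟨h1, h2⟩
      exact hX n ⟨h1, Or.inl ⟨h2, hX'.2.2.1⟩⟩
  refine (measure_mono hA).trans ?_
  rw [hB, key, key]
  set p := q + (1 - q) ^ 2 with hp
  have hp0 : 0 ≤ p := by positivity
  have hg : ∏ n : Fin N, (if n = j ∨ n = j' then 1 else ENNReal.ofReal p)
      = ENNReal.ofReal (p ^ (N - 2)) := by
    rw [Finset.prod_ite]
    simp only [Finset.prod_const, one_pow, one_mul]
    rw [ENNReal.ofReal_pow hp0]
    congr 1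
    have : (Finset.univ.filter fun n : Fin N => ¬ (n = j ∨ n = j')) = ({j, j'} : Finset (Fin N))ᶜ := by
      ext n; simp
    rw [this, Finset.card_compl, Finset.card_pair hjj, Fintype.card_fin]
  rw [← hg, ← Finset.prod_mul_distrib]
  refine Finset.prod_le_prod' (fun n _ => ?_)
  by_cases hn : n = j ∨ n = j'
  · simp [T, hn]
  · have hSn : S n = Set.univ := by
      rw [not_or] at hn
      simp [S, hn.1, hn.2]
    rw [hSn, hνu, mul_one]
    simp only [T, if_neg hn]
    exact col_aux N q hq0 hq1 m i hmi
end
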